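/- arXiv:1309.5131 — 7 statements merged into one kernel-verified Lean document; each statement's English description precedes it below -/
import Mathlib

section
/- A deterministic program f : Σ → Σ satisfies non-interference if and only if the abstraction 𝓗 is backward complete for the additive lift F of f, i.e., for every X : Set Σ, 𝓗(F(𝓗(X))) = 𝓗(F(X)). -/
/-- The abstraction `𝓗` pairing each observable value occurring in `X`
with all internal values. -/
def HH {H L : Type*} (X : Set (H × L)) : Set (H × L) :=
  Set.univ ×ˢ (Prod.snd '' X)

/-- A deterministic program `f : Σ → Σ` satisfies non-interference iff `𝓗` is
backward complete for the additive lift `F := Set.image f` of `f`. -/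
theorem ni_iff_backward_complete {H L : Type*} (f : H × L → H × L) :
    (∀ (l : L) (h₁ h₂ : H), (f (h₁, l)).2 = (f (h₂, l)).2) ↔
      ∀ X : Set (H × L), HH (f '' HH X) = HH (f '' X) := by
  constructor
  · intro hf X
    unfold HH
    congr 1
    ext m
    constructor
    · rintro ⟨_, ⟨⟨h, _⟩, ⟨-, ⟨h', l⟩, hX, rfl⟩, rfl⟩, rfl⟩
      exact ⟨_, ⟨_, hX, rfl⟩, hf l h' h⟩
    · rintro ⟨_, ⟨x, hX, rfl⟩, rfl⟩
      exact ⟨_, ⟨x, ⟨Set.mem_univ _, x, hX, rfl⟩, rfl⟩, rfl⟩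
  · intro hX l h₁ h₂
    have hmem : (h₁, (f (h₁, l)).2) ∈ HH (f '' HH {(h₂, l)}) :=
      ⟨Set.mem_univ _, _, ⟨(h₁, l), ⟨Set.mem_univ _, (h₂, l), rfl, rfl⟩, rfl⟩, rfl⟩
    rw [hX] at hmem
    obtain ⟨-, _, ⟨_, rfl, rfl⟩, h_eq⟩ := hmem
    exact h_eq.symm
end

section
/- A deterministic program f : Σ → Σ satisfies non-interference if and only if the abstraction 𝓗 is forward complete for the weakest-precondition semantics Wlp_f(X) := f⁻¹(X), i.e., for every X : Set Σ, 𝓗(f⁻¹(𝓗(X))) = f⁻¹(𝓗(X)). -/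
theorem mem_HH {H L : Type*} {X : Set (H × L)} {s : H × L} :
    s ∈ HH X ↔ ∃ t ∈ X, t.2 = s.2 := by
  simp [HH]

/-- A deterministic program `f : Σ → Σ` satisfies non-interference iff `𝓗` is
forward complete for the weakest-precondition semantics `Wlp_f := Set.preimage f`. -/
theorem ni_iff_forward_complete_wlp {H L : Type*} (f : H × L → H × L) :
    (∀ (l : L) (h₁ h₂ : H), (f (h₁, l)).2 = (f (h₂, l)).2) ↔
      ∀ X : Set (H × L), HH (f ⁻¹' (HH X)) = f ⁻¹' (HH X) := by
  constructor
  · intro hni X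
    ext ⟨h, l⟩
    simp only [mem_HH, Set.mem_preimage]
    constructor
    · rintro ⟨⟨h', l'⟩, ⟨t, ht, hobs⟩, rfl⟩
      exact ⟨t, ht, hobs.trans (hni l' h' h)⟩
    · intro hx
      exact ⟨(h, l), hx, rfl⟩
  · intro hcomplete l h₁ h₂
    have hmem : (h₂, l) ∈ HH (f ⁻¹' HH {f (h₁, l)}) :=
      mem_HH.2 ⟨(h₁, l), mem_HH.2 ⟨_, rfl, rfl⟩, rfl⟩
    rw [hcomplete] at hmem
    obtain ⟨t, rfl, hobs⟩ := mem_HH.1 hmem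
    exact hobs
end

section
/- Let C be a complete lattice, let f : C → C preserve arbitrary suprema, and let f⁺ := fun x => sSup {y | f y ≤ x} be its upper (right) adjoint. For every upper closure operator ρ on C, ρ is backward complete for f if and only if ρ is forward complete for f⁺; that is, (∀ x, ρ(f(ρ x)) = ρ(f x)) ↔ (∀ x, ρ(f⁺(ρ x)) = f⁺(ρ x)). -/
/-- A map preserving arbitrary suprema is left adjoint to `fun x => sSup {y | f y ≤ x}`. -/
theorem galoisConnection_sSup_of_map_sSup {C D : Type*} [CompleteLattice C] [CompleteLattice D]
    {f : C → D} (hf : ∀ S : Set C, f (sSup S) = sSup (f '' S)) :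
    GaloisConnection f fun x => sSup {y | f y ≤ x} := by
  have hmono : Monotone f := fun a b hab => by
    have h := hf {a, b}
    rw [Set.image_pair, sSup_pair, sSup_pair, sup_eq_right.2 hab] at h
    exact h ▸ le_sup_left
  refine fun a b => ⟨fun h => le_sSup h, fun h => (hmono h).trans ?_⟩
  rw [hf]
  exact sSup_le (Set.forall_mem_image.2 fun _ hy => hy)

/-- For a suprema-preserving map `f` on a complete lattice with upper adjoint
`f⁺ := fun x => sSup {y | f y ≤ x}`, an upper closure operator `ρ` is backward
complete for `f` iff it is forward complete for `f⁺`. -/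
theorem backward_complete_iff_forward_complete_adjoint
    {C : Type*} [CompleteLattice C] (f : C → C)
    (hf : ∀ S : Set C, f (sSup S) = sSup (f '' S))
    (ρ : C → C) (hmono : Monotone ρ) (hidem : ∀ x, ρ (ρ x) = ρ x)
    (hext : ∀ x, x ≤ ρ x) :
    (∀ x, ρ (f (ρ x)) = ρ (f x)) ↔
      (∀ x, ρ (sSup {y | f y ≤ ρ x}) = sSup {y | f y ≤ ρ x}) := by
  have gc := galoisConnection_sSup_of_map_sSup hf
  constructor
  · intro h x
    refine le_antisymm ((gc _ _).1 ?_) (hext _)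
    calc f (ρ (sSup {y | f y ≤ ρ x})) ≤ ρ (f (ρ (sSup {y | f y ≤ ρ x}))) := hext _
      _ = ρ (f (sSup {y | f y ≤ ρ x})) := h _
      _ ≤ ρ (ρ x) := hmono (gc.l_u_le _)
      _ = ρ x := hidem x
  · intro h x
    refine le_antisymm ?_ (hmono (gc.monotone_l (hext x)))
    have hx : f (ρ x) ≤ ρ (f x) :=
      (gc _ _).2 ((hmono ((gc _ _).1 (hext (f x)))).trans (h (f x)).le)
    exact (hmono hx).trans (hidem _).le
end

section
/- Let ρ be an upper closure operator on Set Σ (viewed as a monotone, idempotent, extensive map Set Σ → Set Σ) and f : Σ → Σ. Then ρ is backward complete for the image map of f if and only if ρ is forward complete for the preimage map of f; that is, (∀ X : Set Σ, ρ(f '' ρ(X)) = ρ(f '' X)) ↔ (∀ X : Set Σ, ρ(f⁻¹' (ρ X)) = f⁻¹' (ρ X)). -/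
/-- An upper closure operator `ρ` on `Set Σ` is backward complete for the image
map of `f` iff it is forward complete for the preimage map of `f`. -/
theorem backward_image_iff_forward_preimage
    {σ : Type*} (f : σ → σ) (ρ : Set σ → Set σ)
    (hmono : Monotone ρ) (hidem : ∀ X, ρ (ρ X) = ρ X)
    (hext : ∀ X : Set σ, X ⊆ ρ X) :
    (∀ X : Set σ, ρ (f '' ρ X) = ρ (f '' X)) ↔
      (∀ X : Set σ, ρ (f ⁻¹' (ρ X)) = f ⁻¹' (ρ X)) := by
  constructor
  · intro h X
    refine Set.Subset.antisymm (Set.image_subset_iff.mp ?_) (hext _)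
    calc f '' ρ (f ⁻¹' ρ X) ⊆ ρ (f '' ρ (f ⁻¹' ρ X)) := hext _
      _ = ρ (f '' (f ⁻¹' ρ X)) := h _
      _ ⊆ ρ (ρ X) := hmono (Set.image_preimage_subset f (ρ X))
      _ = ρ X := hidem X
  · intro h X
    refine Set.Subset.antisymm ?_ (hmono (Set.image_mono (hext X)))
    have hX : ρ X ⊆ f ⁻¹' ρ (f '' X) :=
      (hmono (Set.image_subset_iff.mp (hext (f '' X)))).trans (h (f '' X)).subset
    exact (hmono (Set.image_subset_iff.mpr hX)).trans (hidem _).subset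
end

section
/- For any relation R ⊆ Σ × Σ, with post_R(X) := {t | ∃ s ∈ X, R s t} and weakest-precondition map p̃re_R(X) := {s | ∀ t, R s t → t ∈ X}, the abstraction 𝓗 is backward complete for post_R if and only if 𝓗 is forward complete for p̃re_R; that is, (∀ X : Set Σ, 𝓗(post_R(𝓗 X)) = 𝓗(post_R X)) ↔ (∀ X : Set Σ, 𝓗(p̃re_R(𝓗 X)) = p̃re_R(𝓗 X)). -/
/-- The strongest-postcondition map of a relation `R`. -/
def post {σ : Type*} (R : σ → σ → Prop) (X : Set σ) : Set σ :=
  {t | ∃ s ∈ X, R s t}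

/-- The weakest-precondition map of a relation `R`. -/
def pre {σ : Type*} (R : σ → σ → Prop) (X : Set σ) : Set σ :=
  {s | ∀ t, R s t → t ∈ X}

/-- For a Galois connection `l ⊣ u`, a closure operator is backward complete for `l` iff it is
forward complete for `u`. -/
theorem GaloisConnection.backward_complete_iff_forward_complete {α : Type*} [PartialOrder α]
    {l u : α → α} (gc : GaloisConnection l u) (c : ClosureOperator α) :
    (∀ x, c (l (c x)) = c (l x)) ↔ (∀ x, c (u (c x)) = u (c x)) := by
  refine ⟨fun h x => (c.le_closure _).antisymm' (gc.le_u ?_), fun h x => le_antisymm ?_ ?_⟩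
  · calc l (c (u (c x))) ≤ c (l (c (u (c x)))) := c.le_closure _
      _ = c (l (u (c x))) := h _
      _ ≤ c (c x) := c.monotone (gc.l_u_le _)
      _ = c x := c.idempotent x
  · have hx : c x ≤ u (c (l x)) :=
      (c.monotone (gc.le_u (c.le_closure _))).trans (h _).le
    exact (c.monotone (gc.l_le hx)).trans (c.idempotent _).le
  · exact c.monotone (gc.monotone_l (c.le_closure x))

theorem gc_post_pre {σ : Type*} (R : σ → σ → Prop) : GaloisConnection (post R) (pre R) :=
  fun _ _ => ⟨fun h s hs _ hst => h ⟨s, hs, hst⟩, fun h t ⟨_, hs, hst⟩ => h hs t hst⟩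

/-- `𝓗` as a closure operator. -/
def closureHH (H L : Type*) : ClosureOperator (Set (H × L)) :=
  ClosureOperator.mk' HH
    (fun _ _ h _ hs => by
      obtain ⟨t, ht, e⟩ := mem_HH.1 hs
      exact mem_HH.2 ⟨t, h ht, e⟩)
    (fun _ s hs => mem_HH.2 ⟨s, hs, rfl⟩)
    (fun _ _ hs => by
      obtain ⟨t, ht, e⟩ := mem_HH.1 hs
      obtain ⟨r, hr, e'⟩ := mem_HH.1 ht
      exact mem_HH.2 ⟨r, hr, e'.trans e⟩)

/-- `𝓗` is backward complete for `post_R` iff `𝓗` is forward complete for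
the weakest-precondition map `p̃re_R`. -/
theorem backward_post_iff_forward_pre {H L : Type*}
    (R : (H × L) → (H × L) → Prop) :
    (∀ X : Set (H × L), HH (post R (HH X)) = HH (post R X)) ↔
      (∀ X : Set (H × L), HH (pre R (HH X)) = pre R (HH X)) := by
  exact (gc_post_pre R).backward_complete_iff_forward_complete (closureHH H L)
end

section
/- Let ρ_∘ be an additive upper closure operator on Set L and define 𝓗_ρ : Set Σ → Set Σ by 𝓗_ρ(X) := Set.univ ×ˢ ρ_∘(X°). Then the program satisfies abstract non-interference for a dynamic attacker with identity input observation — ∀ x₁ x₂ : Σ, x₁° = x₂° → ρ_∘({(f x₁)°}) = ρ_∘({(f x₂)°}) — if and only if ∀ X : Set Σ, 𝓗_ρ(F(𝓗 X)) = 𝓗_ρ(F X). -/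
/-- The abstraction `𝓗_ρ` determined by a public-output observation `ρ₀`. -/
def HHrho {H L : Type*} (ρ₀ : Set L → Set L) (X : Set (H × L)) : Set (H × L) :=
  Set.univ ×ˢ ρ₀ (Prod.snd '' X)

/-- A set map preserving arbitrary unions is determined by its values on singletons. -/
theorem mem_iff_exists_singleton_of_map_sUnion {A B : Type*} {φ : Set A → Set B}
    (hφ : ∀ 𝒮 : Set (Set A), φ (⋃₀ 𝒮) = ⋃₀ (φ '' 𝒮)) (S : Set A) (b : B) :
    b ∈ φ S ↔ ∃ a ∈ S, b ∈ φ {a} := by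
  have h := hφ ((fun a => {a}) '' S)
  rw [Set.sUnion_image, Set.biUnion_of_singleton] at h
  rw [h]
  simp

/-- For inhabited `H`, the second factor of `HHrho` is determined by the product. -/
theorem HHrho_eq_HHrho_iff {H L : Type*} [Nonempty H] {ρ₀ : Set L → Set L}
    {X Y : Set (H × L)} :
    HHrho ρ₀ X = HHrho ρ₀ Y ↔ ρ₀ (Prod.snd '' X) = ρ₀ (Prod.snd '' Y) := by
  refine ⟨fun h => ?_, fun h => by rw [HHrho, HHrho, h]⟩
  simpa [HHrho, Set.snd_image_prod] using congrArg (Prod.snd '' ·) h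

theorem subset_HH {H L : Type*} (X : Set (H × L)) : X ⊆ HH X :=
  fun x hx => ⟨Set.mem_univ _, x, hx, rfl⟩

/-- Abstract non-interference for a dynamic attacker with identity input
observation and additive output uco `ρ₀` holds iff
`∀ X, 𝓗_ρ(F(𝓗 X)) = 𝓗_ρ(F X)`. -/
theorem ani_dynamic_iff {H L : Type*} (f : H × L → H × L)
    (ρ₀ : Set L → Set L) (hmono : Monotone ρ₀)
    (hidem : ∀ S : Set L, ρ₀ (ρ₀ S) = ρ₀ S)
    (hext : ∀ S : Set L, S ⊆ ρ₀ S)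
    (hadd : ∀ 𝒮 : Set (Set L), ρ₀ (⋃₀ 𝒮) = ⋃₀ (ρ₀ '' 𝒮)) :
    (∀ x₁ x₂ : H × L, x₁.2 = x₂.2 → ρ₀ {(f x₁).2} = ρ₀ {(f x₂).2}) ↔
      (∀ X : Set (H × L), HHrho ρ₀ (f '' HH X) = HHrho ρ₀ (f '' X)) := by
  constructor
  · intro h X
    refine congrArg (Set.univ ×ˢ ·) (Set.Subset.antisymm ?_
      (hmono (Set.image_mono (Set.image_mono (subset_HH X)))))
    intro l hl
    obtain ⟨_, ⟨_, ⟨x, ⟨-, y, hy, hyx⟩, rfl⟩, rfl⟩, hlx⟩ :=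
      (mem_iff_exists_singleton_of_map_sUnion hadd _ l).1 hl
    rw [h x y hyx.symm] at hlx
    exact (mem_iff_exists_singleton_of_map_sUnion hadd _ l).2
      ⟨_, Set.mem_image_of_mem _ (Set.mem_image_of_mem f hy), hlx⟩
  · intro h x₁ x₂ hx
    have : Nonempty H := ⟨x₁.1⟩
    have hHH : HH {x₁} = HH {x₂} := by simp [HH, hx]
    have key : HHrho ρ₀ (f '' {x₁}) = HHrho ρ₀ (f '' {x₂}) := by
      rw [← h {x₁}, hHH, h]
    simpa only [Set.image_singleton] using HHrho_eq_HHrho_iff.1 key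
end

section
/- Let φ_* be a partitioning upper closure operator on Set H and φ_∘ a partitioning upper closure operator on Set L, and define the declassification abstraction 𝓗_φ : Set Σ → Set Σ by 𝓗_φ(X) := ⋃_{o ∈ X°} φ_*({h | (h, o) ∈ X}) ×ˢ φ_∘({o}). Then the program satisfies declassified non-interference with respect to φ — ∀ x₁ x₂ : Σ, φ_*({x₁.1}) = φ_*({x₂.1}) → φ_∘({x₁.2}) = φ_∘({x₂.2}) → (f x₁)° = (f x₂)° — if and only if ∀ X : Set Σ, 𝓗(F(𝓗_φ X)) = 𝓗(F X). -/
theorem singleton_saturation_eq_iff {A : Type*} (r : Setoid A) (φ : Set A → Set A)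
    (hφ : ∀ S : Set A, φ S = {b | ∃ a ∈ S, r.r b a}) (a b : A) :
    φ {a} = φ {b} ↔ r.r a b := by
  simp only [hφ, Set.mem_singleton_iff, exists_eq_left, Set.ext_iff, Set.mem_ofPred_eq]
  exact ⟨fun h => (h a).1 (r.refl a),
    fun h c => ⟨fun hc => r.trans hc h, fun hc => r.trans hc (r.symm h)⟩⟩

theorem mem_HH_iff {H L : Type*} (X : Set (H × L)) (y : H × L) :
    y ∈ HH X ↔ ∃ x ∈ X, x.2 = y.2 := by
  simp [HH]

/-- Declassified non-interference w.r.t. partitioning ucos `φ_*` (on private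
data) and `φ_∘` (on public data) holds iff `𝓗` is backward complete for `F`
precomposed with the declassification abstraction `𝓗_φ`. -/
theorem dni_iff_backward_complete {H L : Type*} (f : H × L → H × L)
    (rH : Setoid H) (φs : Set H → Set H)
    (hφs : ∀ S : Set H, φs S = {b | ∃ a ∈ S, rH.r b a})
    (rL : Setoid L) (φo : Set L → Set L)
    (hφo : ∀ S : Set L, φo S = {b | ∃ a ∈ S, rL.r b a})
    (Hφ : Set (H × L) → Set (H × L))
    (hHφ : ∀ X : Set (H × L),
      Hφ X = ⋃ o ∈ Prod.snd '' X, (φs {h | (h, o) ∈ X} ×ˢ φo {o} : Set (H × L))) :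
    (∀ x₁ x₂ : H × L, φs {x₁.1} = φs {x₂.1} → φo {x₁.2} = φo {x₂.2} →
        (f x₁).2 = (f x₂).2) ↔
      (∀ X : Set (H × L), HH (f '' Hφ X) = HH (f '' X)) := by
  have mem_Hφ (X : Set (H × L)) (y : H × L) :
      y ∈ Hφ X ↔ ∃ x ∈ X, rH.r y.1 x.1 ∧ rL.r y.2 x.2 := by
    rw [hHφ]
    simp only [hφs, hφo, Set.mem_iUnion, Set.mem_prod, Set.mem_ofPred_eq,
      Set.mem_singleton_iff, exists_eq_left]
    constructor
    · rintro ⟨o, -, ⟨h, hX, h₁⟩, h₂⟩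
      exact ⟨(h, o), hX, h₁, h₂⟩
    · rintro ⟨x, hX, h₁, h₂⟩
      exact ⟨x.2, ⟨x, hX, rfl⟩, ⟨x.1, hX, h₁⟩, h₂⟩
  simp only [singleton_saturation_eq_iff rH φs hφs, singleton_saturation_eq_iff rL φo hφo]
  constructor
  · intro hf X
    ext y
    simp only [mem_HH_iff, Set.exists_mem_image, mem_Hφ]
    constructor
    · rintro ⟨z, ⟨x, hX, h₁, h₂⟩, hz⟩
      exact ⟨x, hX, (hf z x h₁ h₂).symm.trans hz⟩
    · rintro ⟨x, hX, hx⟩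
      exact ⟨x, ⟨x, hX, rH.refl _, rL.refl _⟩, hx⟩
  · intro hc x₁ x₂ h₁ h₂
    have hmem : f x₁ ∈ HH (f '' Hφ {x₂}) :=
      (mem_HH_iff _ _).2 ⟨f x₁, ⟨x₁, (mem_Hφ _ _).2 ⟨x₂, rfl, h₁, h₂⟩, rfl⟩, rfl⟩
    rw [hc, mem_HH_iff] at hmem
    obtain ⟨_, ⟨x, rfl, rfl⟩, hx⟩ := hmem
    exact hx.symm
end
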